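/- Let G be a graph with a perfect matching F. If G − V(e) is (n,k)-extendable for every edge e ∈ F, then G is (n,k)-extendable. -/

import Mathlib

/-- `G` is `(n,k)`-extendable: `n + 2k ≤ |V(G)| - 2`, `|V(G)| - n` is even, and for every
set `S` of `n` vertices, `G - S` contains a `k`-matching and every `k`-matching of `G - S`
extends to a perfect matching of `G - S`. -/
def SimpleGraph.NKExtendable {V : Type*} [Finite V] (G : SimpleGraph V) (n k : ℕ) : Prop :=
  n + 2 * k ≤ Nat.card V - 2 ∧ Even (Nat.card V - n) ∧
  ∀ S : Set V, S.ncard = n →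
    (∃ M : G.Subgraph, M.IsMatching ∧ Disjoint M.verts S ∧ M.edgeSet.ncard = k) ∧
    ∀ M : G.Subgraph, M.IsMatching → Disjoint M.verts S → M.edgeSet.ncard = k →
      ∃ F : G.Subgraph, M ≤ F ∧ F.IsMatching ∧ F.verts = Sᶜ

namespace SimpleGraph

variable {V : Type*} {G : SimpleGraph V}

/-- The vertex set `A` is covered exactly by some matching of `G`. -/
def Matchable (G : SimpleGraph V) (A : Finset V) : Prop :=
  ∃ M : G.Subgraph, M.IsMatching ∧ M.verts = A

theorem Subgraph.IsMatching.deleteVerts {M : G.Subgraph} (hM : M.IsMatching) {s : Set V}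
    (hs : ∀ ⦃v w⦄, M.Adj v w → v ∈ s → w ∈ s) : (M.deleteVerts s).IsMatching := by
  intro v hv
  rw [Subgraph.deleteVerts_verts] at hv
  obtain ⟨w, hw, huniq⟩ := hM hv.1
  refine ⟨w, ?_, fun y hy ↦ huniq y (Subgraph.deleteVerts_adj.1 hy).2.2.2.2⟩
  exact Subgraph.deleteVerts_adj.2 ⟨hv.1, hv.2, hw.snd_mem, fun h ↦ hv.2 (hs hw.symm h), hw⟩

theorem Subgraph.IsMatching.deleteVerts_of_le {M N : G.Subgraph} (hN : N.IsMatching)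
    (hM : M.IsMatching) (hle : M ≤ N) : (N.deleteVerts M.verts).IsMatching := by
  refine hN.deleteVerts fun v w hvw hv ↦ ?_
  obtain ⟨x, hx, -⟩ := hM hv
  exact hN.eq_of_adj_left (hle.2 hx) hvw ▸ hx.snd_mem

theorem Subgraph.IsMatching.ncard_verts [Finite V] {M : G.Subgraph} (hM : M.IsMatching) :
    M.verts.ncard = 2 * M.edgeSet.ncard := by
  classical
  have := Fintype.ofFinite V
  have h := M.spanningCoe.sum_degrees_eq_twice_card_edges
  have hd (v : V) : M.spanningCoe.degree v = if v ∈ M.verts then 1 else 0 := by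
    rw [Subgraph.degree_spanningCoe]
    split_ifs with hv
    · exact Subgraph.isMatching_iff_forall_degree.1 hM v hv
    · exact Subgraph.degree_of_notMem_verts hv
  simp only [hd, Finset.sum_boole] at h
  rw [← Subgraph.edgeSet_spanningCoe, ← SimpleGraph.coe_edgeFinset, Set.ncard_coe_finset, ← h,
    Set.ncard_eq_toFinset_card']
  simp only [Nat.cast_id]
  congr 1
  ext v
  simp

namespace Matchable

theorem empty : G.Matchable ∅ := ⟨⊥, fun v hv ↦ hv.elim, by simp⟩

theorem even_card {A : Finset V} (hA : G.Matchable A) : Even A.card := by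
  obtain ⟨M, hM, hMA⟩ := hA
  have : Fintype M.verts := hMA ▸ inferInstance
  convert hM.even_card
  ext v
  simp [hMA]

theorem even_card_filter {A : Finset V} (hA : G.Matchable A) (Q : V → Prop) [DecidablePred Q]
    (hQ : ∀ p ∈ A, ∀ q ∈ A, G.Adj p q → Q p → Q q) : Even (A.filter Q).card := by
  obtain ⟨M, hM, hMA⟩ := hA
  have hmem (v : V) : v ∈ M.verts ↔ v ∈ A := by simp [hMA]
  refine even_card (G := G) ⟨M.deleteVerts {v | ¬ Q v}, hM.deleteVerts ?_, ?_⟩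
  · intro v w hvw hv hw
    exact hv (hQ w ((hmem w).1 hvw.snd_mem) v ((hmem v).1 hvw.fst_mem) hvw.adj_sub.symm hw)
  · ext v
    simp [hmem]

theorem exists_adj {A : Finset V} {a : V} (hA : G.Matchable A) (ha : a ∈ A) :
    ∃ b ∈ A, G.Adj a b ∧ ∀ B : Finset V, (∀ z, z ∈ B ↔ z ∈ A ∧ z ≠ a ∧ z ≠ b) →
      G.Matchable B := by
  obtain ⟨M, hM, hMA⟩ := hA
  have hmem (v : V) : v ∈ M.verts ↔ v ∈ A := by simp [hMA]
  obtain ⟨b, hab, -⟩ := hM ((hmem a).2 ha)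
  refine ⟨b, (hmem b).1 hab.snd_mem, hab.adj_sub, fun B hB ↦
    ⟨M.deleteVerts (G.subgraphOfAdj hab.adj_sub).verts,
      hM.deleteVerts_of_le (.subgraphOfAdj hab.adj_sub) (subgraphOfAdj_le_of_adj M hab), ?_⟩⟩
  ext z
  simp [hB, hmem]

variable [DecidableEq V]

theorem union {A B : Finset V} (hA : G.Matchable A) (hB : G.Matchable B) (hAB : Disjoint A B) :
    G.Matchable (A ∪ B) := by
  obtain ⟨M, hM, hMA⟩ := hA
  obtain ⟨N, hN, hNB⟩ := hB
  refine ⟨M ⊔ N, hM.sup hN ?_, by simp [hMA, hNB]⟩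
  rwa [hM.support_eq_verts, hN.support_eq_verts, hMA, hNB, Finset.disjoint_coe]

theorem pair {a b : V} (hab : G.Adj a b) : G.Matchable {a, b} :=
  ⟨G.subgraphOfAdj hab, .subgraphOfAdj hab, by simp⟩

/-- Adding an edge whose endpoints are the elements of `B \ A`. -/
theorem add_edge {A B : Finset V} {a b : V} (hA : G.Matchable A) (hab : G.Adj a b)
    (ha : a ∉ A) (hb : b ∉ A) (hB : ∀ z, z ∈ B ↔ z = a ∨ z = b ∨ z ∈ A) : G.Matchable B := by
  convert (pair hab).union hA (by simp [ha, hb]) using 1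
  ext z
  simp [hB]

theorem exists_exchange_of_mem_left {A B : Finset V} {w : V} (hA : G.Matchable A)
    (hB : G.Matchable B) (hwA : w ∈ A) (hwB : w ∉ B) :
    ∃ t ∈ symmDiff A B, t ≠ w ∧ G.Matchable (symmDiff A {w, t}) ∧
      G.Matchable (symmDiff B {w, t}) := by
  induction hm : A.card using Nat.strong_induction_on generalizing A B w with
  | _ m ih =>
  obtain ⟨x, hxA, hwx, hAx⟩ := hA.exists_adj hwA
  have hne := hwx.ne
  by_cases hxB : x ∈ B
  · obtain ⟨y, hyB, hxy, hBy⟩ := hB.exists_adj hxB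
    have hne' := hxy.ne
    have hA' : G.Matchable (A \ {w, x}) := hAx _ (by simp)
    have hB' : G.Matchable (B \ {x, y}) := hBy _ (by simp)
    clear hBy hAx
    by_cases hyA : y ∈ A
    · have hlt : (A \ {w, x}).card < m := by
        rw [← hm]
        exact Finset.card_lt_card
          (Finset.sdiff_ssubset (by clear ih; grind) ⟨w, by simp⟩)
      obtain ⟨t, ht, hty, h1, h2⟩ := ih _ hlt hA' hB' (w := y) (by clear ih; grind)
        (by clear ih; grind) rfl
      clear ih
      refine ⟨t, by grind [Finset.mem_symmDiff], by grind [Finset.mem_symmDiff],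
        h1.add_edge hxy ?_ ?_ ?_, h2.add_edge hwx ?_ ?_ ?_⟩ <;> grind [Finset.mem_symmDiff]
    · clear ih
      refine ⟨y, ?_, ?_, hA'.add_edge hxy ?_ ?_ ?_, hB'.add_edge hwx ?_ ?_ ?_⟩ <;>
        grind [Finset.mem_symmDiff]
  · clear ih
    refine ⟨x, ?_, ?_, hAx _ ?_, hB.add_edge hwx ?_ ?_ ?_⟩ <;> clear hAx <;>
      grind [Finset.mem_symmDiff]

/-- Simultaneous exchange property of the matching delta-matroid. -/
theorem exists_exchange {A B : Finset V} {w : V} (hA : G.Matchable A) (hB : G.Matchable B)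
    (hw : w ∈ symmDiff A B) :
    ∃ t ∈ symmDiff A B, t ≠ w ∧ G.Matchable (symmDiff A {w, t}) ∧
      G.Matchable (symmDiff B {w, t}) := by
  rcases Finset.mem_symmDiff.1 hw with h | h
  · exact hA.exists_exchange_of_mem_left hB h.1 h.2
  · obtain ⟨t, ht, hne, h1, h2⟩ := hB.exists_exchange_of_mem_left hA h.1 h.2
    exact ⟨t, symmDiff_comm A B ▸ ht, hne, h2, h1⟩

end Matchable

theorem nkExtendable_iff_matchable [Fintype V] [DecidableEq V] {n k : ℕ} :
    G.NKExtendable n k ↔ n + 2 * k ≤ Nat.card V - 2 ∧ Even (Nat.card V - n) ∧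
      ∀ S : Finset V, S.card = n →
        (∃ W, G.Matchable W ∧ Disjoint W S ∧ W.card = 2 * k) ∧
        ∀ W, G.Matchable W → Disjoint W S → W.card = 2 * k → G.Matchable (S ∪ W)ᶜ := by
  refine and_congr_right fun _ ↦ and_congr_right fun _ ↦ ⟨fun h S hS ↦ ?_, fun h S hS ↦ ?_⟩
  · obtain ⟨⟨M, hM, hMS, hMk⟩, hext⟩ := h S (by simpa using hS)
    refine ⟨⟨M.verts.toFinite.toFinset, ⟨M, hM, by simp⟩, ?_, ?_⟩, ?_⟩
    · rw [← Finset.disjoint_coe]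
      simpa using hMS
    · rw [← Set.ncard_eq_toFinset_card, hM.ncard_verts, hMk]
    · rintro W ⟨N, hN, hNW⟩ hWS hWk
      have hNk : N.edgeSet.ncard = k := by
        have := hN.ncard_verts
        rw [hNW, Set.ncard_coe_finset] at this
        omega
      obtain ⟨F, hNF, hF, hFS⟩ := hext N hN (by rwa [hNW, Finset.disjoint_coe]) hNk
      refine ⟨F.deleteVerts N.verts, hF.deleteVerts_of_le hN hNF, ?_⟩
      ext z
      simp [hFS, hNW]
  · obtain ⟨⟨W, ⟨M, hM, hMW⟩, hWS, hWk⟩, hext⟩ := h S.toFinite.toFinset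
      (by rw [← Set.ncard_eq_toFinset_card, hS])
    refine ⟨⟨M, hM, ?_, ?_⟩, fun N hN hNS hNk ↦ ?_⟩
    · rw [← Finset.disjoint_coe] at hWS
      simpa [hMW] using hWS
    · have := hM.ncard_verts
      rw [hMW, Set.ncard_coe_finset] at this
      omega
    · obtain ⟨P, hP, hPN⟩ := hext N.verts.toFinite.toFinset ⟨N, hN, by simp⟩
        (by rw [← Finset.disjoint_coe]; simpa using hNS)
        (by rw [← Set.ncard_eq_toFinset_card, hN.ncard_verts, hNk])
      refine ⟨N ⊔ P, le_sup_left, hN.sup hP ?_, ?_⟩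
      · rw [hN.support_eq_verts, hP.support_eq_verts, hPN, Set.disjoint_left]
        intro z hz
        simp [hz]
      · ext z
        have hzS : z ∈ N.verts → z ∉ S := fun hz ↦ Set.disjoint_left.1 hNS hz
        simp only [Subgraph.verts_sup, hPN]
        simp
        tauto

theorem Matchable.of_induce {s : Set V} {A : Finset s} (hA : (G.induce s).Matchable A) :
    G.Matchable (A.map (.subtype _)) := by
  obtain ⟨M, hM, hMA⟩ := hA
  refine ⟨M.map (Embedding.induce s).toHom, hM.map _ Subtype.val_injective, ?_⟩
  ext z
  simp [hMA]

theorem Matchable.induce {s : Set V} [DecidablePred (· ∈ s)] {A : Finset V} (hA : G.Matchable A)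
    (hs : ∀ z ∈ A, z ∈ s) : (G.induce s).Matchable (A.subtype (· ∈ s)) := by
  obtain ⟨M, hM, hMA⟩ := hA
  have hmem (v : V) : v ∈ M.verts ↔ v ∈ A := by simp [hMA]
  refine ⟨M.comap (Embedding.induce s).toHom, fun v hv ↦ ?_, ?_⟩
  · obtain ⟨w, hw, huniq⟩ := hM hv
    exact ⟨⟨w, hs w ((hmem w).1 hw.snd_mem)⟩, ⟨hw.adj_sub, hw⟩,
      fun y hy ↦ Subtype.ext (huniq y hy.2)⟩
  · ext z
    simp [hmem]

/-- The graph `G - {u, v}` contains `k`-matchings avoiding any `n` vertices, and any such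
`k`-matching extends to a matching covering all other vertices of `G - {u, v}`; matchings are
represented by the sets of vertices they cover. -/
def DeletedExtendable [Fintype V] (G : SimpleGraph V) (n k : ℕ) (u v : V) : Prop :=
  ∀ T : Finset V, T.card = n → u ∉ T → v ∉ T →
    (∃ W, G.Matchable W ∧ Disjoint W T ∧ u ∉ W ∧ v ∉ W ∧ W.card = 2 * k) ∧
    ∀ W, G.Matchable W → Disjoint W T → u ∉ W → v ∉ W → W.card = 2 * k →
      ∀ X : Finset V, (∀ z, z ∈ X ↔ z ≠ u ∧ z ≠ v ∧ z ∉ T ∧ z ∉ W) → G.Matchable X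

theorem NKExtendable.deletedExtendable [Fintype V] [DecidableEq V] {n k : ℕ} {u v : V}
    (h : (G.induce ({u, v}ᶜ : Set V)).NKExtendable n k) : G.DeletedExtendable n k u v := by
  classical
  intro T hT huT hvT
  have hcard {A : Finset V} (hu : u ∉ A) (hv : v ∉ A) :
      (A.subtype (· ∈ ({u, v}ᶜ : Set V))).card = A.card := by
    rw [Finset.card_subtype, Finset.filter_true_of_mem]
    grind
  obtain ⟨⟨W, hW, hWT, hWk⟩, hext⟩ := (nkExtendable_iff_matchable.1 h).2.2
    (T.subtype (· ∈ ({u, v}ᶜ : Set V))) (by rw [hcard huT hvT, hT])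
  refine ⟨⟨_, hW.of_induce, ?_, ?_, ?_, by simpa using hWk⟩, ?_⟩
  · rw [Finset.disjoint_left] at hWT ⊢
    simp at hWT ⊢
    grind
  · simp
  · simp
  · intro W hW hWT huW hvW hWk X hX
    convert (hext _ (hW.induce (s := {u, v}ᶜ) (by grind)) ?_
      (by rw [hcard huW hvW, hWk])).of_induce using 1
    · ext z
      simp [hX]
      tauto
    · rw [Finset.disjoint_left] at hWT ⊢
      simp at hWT ⊢
      grind

/-- If `G - {u, v}` extends `k`-matchings then it also extends `(k - 1)`-matchings. -/
theorem DeletedExtendable.matchable_of_card_add_two [Fintype V] [DecidableEq V] {n k : ℕ} {u v : V}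
    (h : G.DeletedExtendable n k u v) (hcard : n + 2 * k + 4 ≤ Fintype.card V)
    {T W X : Finset V} (hT : T.card = n) (huT : u ∉ T) (hvT : v ∉ T) (hW : G.Matchable W)
    (hWT : Disjoint W T) (huW : u ∉ W) (hvW : v ∉ W) (hWk : W.card + 2 = 2 * k)
    (hX : ∀ z, z ∈ X ↔ z ≠ u ∧ z ≠ v ∧ z ∉ T ∧ z ∉ W) : G.Matchable X := by
  obtain ⟨⟨W₀, hW₀, hW₀T, huW₀, hvW₀, hW₀k⟩, hext⟩ := h T hT huT hvT
  have hX4 : 4 ≤ X.card := by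
    have hXc : Xᶜ = {u, v} ∪ (T ∪ W) := by
      ext z
      simp [hX]
      tauto
    have h1 := Finset.card_add_card_compl X
    have h2 := Finset.card_union_le {u, v} (T ∪ W)
    have h3 := Finset.card_union_le T W
    have h4 := Finset.card_le_two (a := u) (b := v)
    rw [hXc] at h1
    omega
  rw [Finset.disjoint_left] at hWT
  have hZ : G.Matchable (X ∪ W) := by
    convert hW₀.union (hext W₀ hW₀ hW₀T huW₀ hvW₀ hW₀k ((X ∪ W) \ W₀) ?_) ?_ using 1
    · ext z
      rw [Finset.disjoint_left] at hW₀T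
      have := @hW₀T z
      simp [hX]
      grind
    · intro z
      have := @hWT z
      simp [hX]
      grind
    · exact Finset.disjoint_sdiff
  obtain ⟨w, hw⟩ : X.Nonempty := Finset.card_pos.1 (by omega)
  have hwX := (hX w).1 hw
  obtain ⟨t, ht, htw, h1, -⟩ := hW.exists_exchange hZ (w := w)
    (by simp [Finset.mem_symmDiff, hw, hwX])
  have htX : t ∈ X := by
    clear hext
    grind [Finset.mem_symmDiff]
  have htX' := (hX t).1 htX
  have hadd {a b : V} (ha : a ∈ X) (hb : b ∈ X) (hab : a ≠ b) (hm : G.Matchable (W ∪ {a, b})) :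
      G.Matchable (X \ {a, b}) := by
    rw [hX] at ha hb
    have hext' := hext _ hm
    clear hext
    refine hext' ?_ ?_ ?_ ?_ _ ?_
    · rw [Finset.disjoint_left]
      grind
    · grind
    · grind
    · rw [Finset.card_union_of_disjoint (by simp; grind), Finset.card_pair hab, hWk]
    · intro z
      simp [hX]
      tauto
  clear hext
  have h2 : G.Matchable (X \ {w, t}) := by
    refine hadd hw htX htw.symm ?_
    convert h1 using 1
    clear hadd hX
    ext z
    grind [Finset.mem_symmDiff]
  obtain ⟨y, hy⟩ : (X \ {w, t}).Nonempty := by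
    have h1 := Finset.le_card_sdiff {w, t} X
    have h2 := Finset.card_le_two (a := w) (b := t)
    exact Finset.card_pos.1 (by omega)
  obtain ⟨z, hz, hyz, -⟩ := h2.exists_adj hy
  have hyX : y ∈ X := (Finset.mem_sdiff.1 hy).1
  have hzX : z ∈ X := (Finset.mem_sdiff.1 hz).1
  refine (hadd hyX hzX hyz.ne ?_).add_edge hyz (by simp) (by simp) (by clear hadd; grind)
  have hyX' := (hX y).1 hyX
  have hzX' := (hX z).1 hzX
  exact hW.add_edge hyz hyX'.2.2.2 hzX'.2.2.2 (by clear hadd; grind)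

/-- Gallai's lemma: not being simultaneously missed is a transitive relation. -/
theorem not_matchable_sdiff_pair_trans [DecidableEq V] {U : Finset V} {u w z : V}
    (hU : ¬ G.Matchable U) (hw : ∃ t ∈ U, t ≠ w ∧ G.Matchable (U \ {w, t})) (hwU : w ∈ U)
    (huU : u ∈ U) (hzU : z ∈ U) (hwu : w ≠ u) (hwz : w ≠ z) (huz : u ≠ z)
    (h₁ : ¬ G.Matchable (U \ {u, w})) (h₂ : ¬ G.Matchable (U \ {w, z})) :
    ¬ G.Matchable (U \ {u, z}) := by
  intro h
  obtain ⟨t, htU, htw, ht⟩ := hw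
  obtain ⟨x, hx, hxw, hx1, hx2⟩ := h.exists_exchange ht (w := w) (by grind [Finset.mem_symmDiff])
  have hx' : x = u ∨ x = z ∨ x = t := by grind [Finset.mem_symmDiff]
  rcases hx' with rfl | rfl | rfl
  · apply h₂
    convert hx1 using 1
    ext y
    grind [Finset.mem_symmDiff]
  · apply h₁
    convert hx1 using 1
    ext y
    grind [Finset.mem_symmDiff]
  · apply hU
    convert hx2 using 1
    ext y
    grind [Finset.mem_symmDiff]

/-- Suppose that `R` assigns to each vertex a neighbour, injectively, and that deleting the
endpoints of any of these edges leaves an extendable graph. Then the vertices outside an `n`-set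
`S` and outside a `k`-matching disjoint from `S` can be matched. -/
theorem matchable_of_deletedExtendable [Fintype V] [DecidableEq V] {n k : ℕ} {R : V → V → Prop}
    (hadj : ∀ u v, R u v → G.Adj u v) (hR : ∀ u, ∃ v, R u v)
    (hinj : ∀ u w v, R u v → R w v → u = w)
    (hcard : n + 2 * k + 4 ≤ Fintype.card V) (h : ∀ u v, R u v → G.DeletedExtendable n k u v)
    {S W U : Finset V} (hS : S.card = n) (hW : G.Matchable W) (hWS : Disjoint W S)
    (hWk : W.card = 2 * k) (hmem : ∀ z, z ∈ U ↔ z ∉ S ∧ z ∉ W) : G.Matchable U := by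
  by_contra hU
  have hUcard : 4 ≤ U.card := by
    have hUc : Uᶜ = S ∪ W := by
      ext z
      simp [hmem]
      tauto
    have h1 := Finset.card_add_card_compl U
    have h2 := Finset.card_union_le S W
    rw [hUc] at h1
    omega
  have hdisj : ∀ z ∈ W, z ∉ S := fun z ↦ (Finset.disjoint_left.1 hWS ·)
  have hUU : ∀ u v, R u v → u ∈ U → v ∉ U := by
    intro u v huv hu hv
    have hu' := (hmem u).1 hu
    have hv' := (hmem v).1 hv
    refine hU (((h u v huv S hS hu'.1 hv'.1).2 W hW hWS hu'.2 hv'.2 hWk (U \ {u, v}) ?_).add_edge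
      (hadj u v huv) (by simp) (by simp) ?_)
    · intro z
      simp [hmem]
      tauto
    · clear h
      grind
  have hUS : ∀ u v, R u v → u ∈ U → v ∈ S → ∀ w ∈ U, w ≠ u → G.Matchable (U \ {u, w}) := by
    intro u v huv hu hv w hw hwu
    have h' := h u v huv (insert w (S.erase v))
    clear h
    have hu' := (hmem u).1 hu
    have hw' := (hmem w).1 hw
    have hvW : v ∉ W := fun hvW ↦ hdisj v hvW hv
    refine (h' ?_ ?_ ?_).2 W hW ?_ hu'.2 hvW hWk _ ?_
    · rw [Finset.card_insert_of_notMem (by simp [hw'.1]), Finset.card_erase_add_one hv, hS]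
    · grind
    · grind
    · rw [Finset.disjoint_left]
      grind
    · grind
  have hUW : ∀ u v x, R u v → u ∈ U → v ∈ W → x ∈ W → G.Matchable (W \ {v, x}) →
      ∀ w ∈ U, w ≠ u → G.Adj x w → v ≠ x → G.Matchable (U \ {u, w}) := by
    intro u v x huv hu hv hx hvx w hw hwu hxw hne
    have h' := h u v huv S hS
    clear h
    have hu' := (hmem u).1 hu
    have hw' := (hmem w).1 hw
    refine (h' hu'.1 (hdisj v hv)).2 (insert w (W.erase v)) ?_ ?_ ?_ ?_ ?_ _ ?_
    · exact hvx.add_edge hxw (by simp) (by grind) (by grind)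
    · rw [Finset.disjoint_left]
      grind
    · grind
    · grind
    · rw [Finset.card_insert_of_notMem (by simp [hw'.2]), Finset.card_erase_add_one hv, hWk]
    · grind
  have hUW' : ∀ u v x, R u v → u ∈ U → v ∈ W → x ∈ W → G.Matchable (W \ {v, x}) → v ≠ x →
      ∃ w ∈ U, w ≠ u ∧ G.Adj x w := by
    intro u v x huv hu hv hx hvx hne
    have h' := h u v huv
    clear h
    have hu' := (hmem u).1 hu
    have h1 : G.Matchable (insert x (U.erase u)) := by
      refine h'.matchable_of_card_add_two hcard hS hu'.1 (hdisj v hv) hvx ?_ ?_ ?_ ?_ ?_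
      · rw [Finset.disjoint_left]
        grind
      · grind
      · grind
      · have h1 := Finset.card_sdiff_add_card_eq_card
          (show {v, x} ⊆ W by simp [Finset.insert_subset_iff, hv, hx])
        rw [Finset.card_pair hne] at h1
        omega
      · grind
    obtain ⟨w, hw, hxw, -⟩ := h1.exists_adj (Finset.mem_insert_self _ _)
    have := hxw.ne
    exact ⟨w, by grind, by grind, hxw⟩
  have hmiss : ∀ z ∈ U, ∃ t ∈ U, t ≠ z ∧ G.Matchable (U \ {z, t}) := by
    intro z hz
    obtain ⟨v, hzv⟩ := hR z
    have hv := hUU z v hzv hz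
    by_cases hvS : v ∈ S
    · obtain ⟨t, ht, htz⟩ := Finset.exists_mem_ne (by omega : 1 < U.card) z
      exact ⟨t, ht, htz, hUS z v hzv hz hvS t ht htz⟩
    · have hvW : v ∈ W := by
        clear h
        grind
      obtain ⟨x, hx, hvx, hWx⟩ := hW.exists_adj hvW
      have hWx' : G.Matchable (W \ {v, x}) := hWx _ (by simp)
      obtain ⟨t, ht, htz, hxt⟩ := hUW' z v x hzv hz hvW hx hWx' hvx.ne
      exact ⟨t, ht, htz, hUW z v x hzv hz hvW hx hWx' t ht htz hxt hvx.ne⟩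
  have hnadj : ∀ p ∈ U, ∀ q ∈ U, G.Adj p q → ¬ G.Matchable (U \ {p, q}) := by
    intro p hp q hq hpq hm
    exact hU (hm.add_edge hpq (by simp) (by simp) (by clear h hUU hUS hUW hUW' hmiss; grind))
  obtain ⟨u, hu, c, hc, huc⟩ : ∃ u ∈ U, ∃ c ∈ U, G.Adj u c := by
    obtain ⟨z, hz⟩ : U.Nonempty := Finset.card_pos.1 (by omega)
    obtain ⟨t, -, -, ht⟩ := hmiss z hz
    have h1 := Finset.le_card_sdiff {z, t} U
    have h2 := Finset.card_le_two (a := z) (b := t)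
    obtain ⟨u, hu⟩ : (U \ {z, t}).Nonempty := Finset.card_pos.1 (by omega)
    obtain ⟨c, hc, huc, -⟩ := ht.exists_adj hu
    exact ⟨u, (Finset.mem_sdiff.1 hu).1, c, (Finset.mem_sdiff.1 hc).1, huc⟩
  have hmate : ∀ p ∈ U, ∀ q ∈ U, G.Adj p q → ∃ v ∈ W, R p v := by
    intro p hp q hq hpq
    obtain ⟨v, hv⟩ := hR p
    refine ⟨v, ?_, hv⟩
    have h1 := hUU p v hv hp
    by_contra h2
    refine hnadj p hp q hq hpq (hUS p v hv hp ?_ q hq hpq.ne')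
    by_contra h3
    exact h1 ((hmem v).2 ⟨h3, h2⟩)
  obtain ⟨v, hvW, huv⟩ := hmate u hu c hc huc
  obtain ⟨a, haW, hca⟩ := hmate c hc u hu huc.symm
  have hR_adj := hadj c a hca
  obtain ⟨x, hxW, hvx, hWvx⟩ := hW.exists_adj hvW
  replace hWvx : G.Matchable (W \ {v, x}) := hWvx _ (by simp)
  have hxU : ∀ w ∈ U, w ≠ u → G.Adj x w → G.Matchable (U \ {u, w}) :=
    fun w hw hwu hxw ↦ hUW u v x huv hu hvW hxW hWvx w hw hwu hxw hvx.ne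
  have hav : a ≠ v := by
    rintro rfl
    exact huc.ne (hinj u c a huv hca)
  have hax : a ≠ x := by
    rintro rfl
    exact hnadj u hu c hc huc (hxU c hc huc.ne' hR_adj.symm)
  obtain ⟨b, hb, hab, hWb⟩ := hWvx.exists_adj (a := a) (by simp [haW, hav, hax])
  replace hWb : G.Matchable (W \ {v, x, a, b}) := hWb _ (by intro z; simp; tauto)
  simp only [Finset.mem_sdiff, Finset.mem_insert, Finset.mem_singleton, not_or] at hb
  have hWab : G.Matchable (W \ {a, b}) := by
    refine hWb.add_edge hvx (by simp) (by simp) ?_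
    clear h hUU hUS hUW hUW' hmiss hnadj hmate hxU
    grind
  obtain ⟨d, hd, hdc, hbd⟩ := hUW' c a b hca hc haW hb.1 hWab hab.ne
  have hcd := hUW c a b hca hc haW hb.1 hWab d hd hdc hbd hab.ne
  have hdu : d ≠ u := by
    rintro rfl
    exact hnadj c hc d hu huc.symm hcd
  have hu' := (hmem u).1 hu
  have hc' := (hmem c).1 hc
  have hd' := (hmem d).1 hd
  have hX : G.Matchable (insert x (U \ {u, c, d})) := by
    have h' := h u v huv S hS hu'.1 (hdisj v hvW)
    have huc' := huc.ne
    have hvx' := hvx.ne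
    have hab' := hab.ne
    clear h hUU hUS hUW hUW' hmiss hnadj hmate hxU hadj hR hinj
    have h1 : G.Matchable (insert a (insert c (W \ {v, x, a, b}))) :=
      hWb.add_edge hR_adj.symm (by simp) (by simp [hc']) (by simp)
    have h2 : G.Matchable (insert c (insert d (W \ {v, x}))) :=
      h1.add_edge hbd (by clear h' hmem hdisj; grind) (by clear h' hmem hdisj; grind)
        (by clear h' hmem hdisj; grind)
    refine h'.2 _ h2 ?_ ?_ ?_ ?_ _ ?_
    · rw [Finset.disjoint_left]
      clear h'
      grind
    · clear h'
      grind
    · clear h'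
      grind
    · rw [Finset.card_insert_of_notMem (by clear h'; grind), Finset.card_insert_of_notMem (by clear h'; grind)]
      have h3 := Finset.card_sdiff_add_card_eq_card
        (show {v, x} ⊆ W by simp [Finset.insert_subset_iff, hvW, hxW])
      rw [Finset.card_pair hvx'] at h3
      omega
    · clear h'
      grind
  obtain ⟨y, hy, hxy, hXy⟩ := hX.exists_adj (Finset.mem_insert_self _ _)
  have hxne := hxy.ne
  have hxU' : x ∉ U := fun hxU' ↦ ((hmem x).1 hxU').2 hxW
  replace hy : y ∈ U ∧ y ≠ u ∧ y ≠ c ∧ y ≠ d := by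
    simpa [hxne.symm] using hy
  replace hXy : G.Matchable (U \ {u, c, d, y}) := hXy _ (by
    clear h hUU hUS hUW hUW' hmiss hnadj hmate hxU
    grind)
  have huy := hxU y hy.1 hy.2.1 hxy
  have hud : G.Matchable (U \ {u, d}) := by
    by_contra hud
    exact not_matchable_sdiff_pair_trans hU (hmiss u hu) hu hc hd huc.ne hdu.symm hdc.symm
      (hnadj c hc u hu huc.symm) hud hcd
  have hclosed : ∀ p ∈ U \ {u}, ∀ q ∈ U \ {u}, G.Adj p q → ¬ G.Matchable (U \ {u, p}) →
      ¬ G.Matchable (U \ {u, q}) := by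
    intro p hp q hq hpq hup
    simp only [Finset.mem_sdiff, Finset.mem_singleton] at hp hq
    exact not_matchable_sdiff_pair_trans hU (hmiss p hp.1) hp.1 hu hq.1 hp.2 hpq.ne
      (Ne.symm hq.2) hup (hnadj p hp.1 q hq.1 hpq)
  have hcQ := hnadj u hu c hc huc
  clear h hUU hUS hUW hUW' hmiss hnadj hmate hxU
  classical
  have hsub {B : Finset V} : ∀ p ∈ U \ insert u B, p ∈ U \ {u} := by
    intro p
    simp
    tauto
  have e1 := huy.even_card_filter (fun z ↦ ¬ G.Matchable (U \ {u, z}))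
    fun p hp q hq ↦ hclosed p (hsub p hp) q (hsub q hq)
  have e2 := hXy.even_card_filter (fun z ↦ ¬ G.Matchable (U \ {u, z}))
    fun p hp q hq ↦ hclosed p (hsub p hp) q (hsub q hq)
  have heq : (U \ {u, y}).filter (fun z ↦ ¬ G.Matchable (U \ {u, z})) =
      insert c ((U \ {u, c, d, y}).filter (fun z ↦ ¬ G.Matchable (U \ {u, z}))) := by
    have huc' := huc.ne
    ext z
    by_cases hzc : z = c
    · subst hzc
      simp [hc, hcQ, hy.2.2.1.symm, huc'.symm]
    · by_cases hzd : z = d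
      · subst hzd
        simp [hud, hzc]
      · simp [hzc, hzd]
  rw [heq, Finset.card_insert_of_notMem (by simp)] at e1
  exact (Nat.even_add_one.1 e1) e2

end SimpleGraph

/-- If `F` is a perfect matching of `G` and `G - V(e)` is `(n,k)`-extendable for every edge
`e ∈ F`, then `G` is `(n,k)`-extendable. -/
theorem nkExtendable_of_deleted_perfectMatching_edges {V : Type*} [Finite V]
    (G : SimpleGraph V) (n k : ℕ)
    (hcard : n + 2 * k ≤ Nat.card V - 2)
    (heven : Even (Nat.card V - n))
    (F : G.Subgraph) (hF : F.IsPerfectMatching)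
    (h : ∀ u v : V, F.Adj u v →
      (G.induce ({u, v}ᶜ : Set V)).NKExtendable n k) :
    G.NKExtendable n k := by
  classical
  have := Fintype.ofFinite V
  refine SimpleGraph.nkExtendable_iff_matchable.2 ⟨hcard, heven, fun S hS ↦ ?_⟩
  by_cases hnk : n = 0 ∧ k = 0
  · obtain ⟨rfl, rfl⟩ := hnk
    rw [Finset.card_eq_zero] at hS
    subst hS
    refine ⟨⟨∅, .empty, by simp, rfl⟩, fun W hW _ hWk ↦ ?_⟩
    rw [mul_zero, Finset.card_eq_zero] at hWk
    subst hWk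
    exact ⟨F, hF.1, by simpa using hF.2.verts_eq_univ⟩
  have hRex : ∀ u, ∃ v, F.Adj u v := fun u ↦ (hF.1 (hF.2 u)).exists
  have hbig : n + 2 * k + 4 ≤ Fintype.card V := by
    rw [Nat.card_eq_fintype_card] at hcard
    have hpos : 0 < Fintype.card V := by omega
    obtain ⟨u⟩ := Fintype.card_pos_iff.1 hpos
    obtain ⟨v, huv⟩ := hRex u
    have h1 := (h u v huv).1
    have h2 := Set.ncard_add_ncard_compl ({u, v} : Set V)
    rw [Set.ncard_pair huv.adj_sub.ne, Nat.card_eq_fintype_card] at h2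
    rw [Nat.card_coe_set_eq] at h1
    omega
  have hdel : ∀ u v, F.Adj u v → G.DeletedExtendable n k u v :=
    fun u v huv ↦ (h u v huv).deletedExtendable
  refine ⟨?_, fun W hW hWS hWk ↦ G.matchable_of_deletedExtendable (fun u v huv ↦ huv.adj_sub) hRex
    (fun u w v ↦ hF.1.eq_of_adj_right) hbig hdel hS hW hWS hWk (by simp)⟩
  have hSc := Finset.card_add_card_compl S
  obtain ⟨u, hu⟩ : Sᶜ.Nonempty := Finset.card_pos.1 (by omega)
  rw [Finset.mem_compl] at hu
  obtain ⟨v, huv⟩ := hRex u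
  by_cases hv : v ∈ S
  · obtain ⟨w, hw, hwu⟩ := Finset.exists_mem_ne (by omega : 1 < Sᶜ.card) u
    rw [Finset.mem_compl] at hw
    obtain ⟨⟨W, hW, hWT, huW, hvW, hWk⟩, -⟩ := hdel u v huv (insert w (S.erase v))
      (by rw [Finset.card_insert_of_notMem (by simp [hw]), Finset.card_erase_add_one hv, hS])
      (by clear hdel; grind) (by clear hdel; grind)
    refine ⟨W, hW, ?_, hWk⟩
    clear hdel
    rw [Finset.disjoint_left] at hWT ⊢
    grind
  · obtain ⟨⟨W, hW, hWS, -, -, hWk⟩, -⟩ := hdel u v huv S hS hu hv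
    exact ⟨W, hW, hWS, hWk⟩
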